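/- arXiv:2010.01293 — 2 statements merged into one kernel-verified Lean document; each statement's English description precedes it below -/
import Mathlib

section
/- Let c* ∈ F_d satisfy R(c*) = c*. Then R is differentiable at c* and R′(c*) > 2; in particular the fixed point c* of the period-tripling renormalization map R is expanding. -/
/-- The unimodal map `u_c(x) = 1 - ((x - c)/(1 - c))^2`. -/
noncomputable def u (c x : ℝ) : ℝ := 1 - ((x - c) / (1 - c)) ^ 2

/-- `uIter c k = u_c^k(0)`, the `k`-th iterate of `u_c` at `0`. -/
noncomputable def uIter (c : ℝ) (k : ℕ) : ℝ := (u c)^[k] 0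

/-- Period-tripling scaling function `S₁(c) = u_c³(0)`. -/
noncomputable def S1 (c : ℝ) : ℝ := uIter c 3
/-- Period-tripling scaling function `S₂(c) = u_c⁴(0) − u_c(0)`. -/
noncomputable def S2 (c : ℝ) : ℝ := uIter c 4 - uIter c 1
/-- Period-tripling scaling function `S₃(c) = 1 − u_c²(0)`. -/
noncomputable def S3 (c : ℝ) : ℝ := 1 - uIter c 2
/-- Gap function `G_l(c) = u_c(0) − u_c³(0)`. -/
noncomputable def Gl (c : ℝ) : ℝ := uIter c 1 - uIter c 3
/-- Gap function `G_r(c) = u_c²(0) − u_c⁴(0)`. -/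
noncomputable def Gr (c : ℝ) : ℝ := uIter c 2 - uIter c 4
/-- The period-tripling renormalization map `R(c) = (u_c⁴(0) − c)/S₂(c)`. -/
noncomputable def Rmap (c : ℝ) : ℝ := (uIter c 4 - c) / S2 c
/-- The feasible domain `F_d`. -/
def Fd : Set ℝ :=
  {c | c ∈ Set.Ioo (0 : ℝ) (1 / 2) ∧ 0 < S1 c ∧ 0 < S2 c ∧ 0 < S3 c ∧ 0 < Gl c ∧ 0 < Gr c}


lemma pw {a b : ℝ} (ha : 0 ≤ a) (h : a ≤ b) (n : ℕ) : a ^ n ≤ b ^ n := pow_le_pow_left₀ ha h n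
lemma pwl {a b : ℝ} (ha : 0 ≤ a) (h : a < b) (n : ℕ) (hn : n ≠ 0) : a ^ n < b ^ n :=
  pow_lt_pow_left₀ h ha hn

noncomputable def sF (t : ℝ) : ℝ := t ^ 3 + t ^ 2 - 1
noncomputable def wF (t : ℝ) : ℝ := 2 * (1 + t) ^ 2 * sF t ^ 2 - (1 + t) ^ 3 * sF t ^ 4
noncomputable def qF (t : ℝ) : ℝ := 2 * t * wF t - wF t ^ 2
noncomputable def FF (t : ℝ) : ℝ := 1 - sF t / ((1 + t) * qF t)
noncomputable def sD (t : ℝ) : ℝ := 3 * t ^ 2 + 2 * t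
noncomputable def wD (t : ℝ) : ℝ :=
  4 * (1 + t) ^ 2 * sF t * sD t * (1 - (1 + t) * sF t ^ 2)
    + (1 + t) * sF t ^ 2 * (4 - 3 * ((1 + t) * sF t ^ 2))
noncomputable def qD (t : ℝ) : ℝ := 2 * wF t + 2 * (t - wF t) * wD t

lemma sF_deriv (t : ℝ) : HasDerivAt sF (sD t) t := by
  have h := (((hasDerivAt_id t).pow 3).add ((hasDerivAt_id t).pow 2)).sub_const 1
  refine HasDerivAt.congr_deriv (f := sF) h ?_
  simp [sD]

lemma wF_deriv (t : ℝ) : HasDerivAt wF (wD t) t := by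
  have ha : HasDerivAt (fun t : ℝ => 1 + t) 1 t := (hasDerivAt_id t).const_add 1
  have hs := sF_deriv t
  have h := (((ha.pow 2).const_mul 2).mul (hs.pow 2)).sub ((ha.pow 3).mul (hs.pow 4))
  refine HasDerivAt.congr_deriv (f := wF) h ?_
  simp [wD]
  ring

lemma qF_deriv (t : ℝ) : HasDerivAt qF (qD t) t := by
  have hw := wF_deriv t
  have h := ((((hasDerivAt_id t).const_mul 2)).mul hw).sub (hw.pow 2)
  refine HasDerivAt.congr_deriv (f := qF) h ?_
  simp [qD]
  ring

lemma y_iter (c x : ℝ) (hc : c < 1) :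
    (1 + c / (1 - c)) * u c x - c / (1 - c)
      = 1 - (1 + c / (1 - c)) * ((1 + c / (1 - c)) * x - c / (1 - c)) ^ 2 := by
  have : (1 - c) ≠ 0 := by linarith
  unfold u
  field_simp
  ring

lemma x_iter (c x : ℝ) (hc : c < 1) :
    u c x = 1 - ((1 + c / (1 - c)) * x - c / (1 - c)) ^ 2 := by
  have : (1 - c) ≠ 0 := by linarith
  unfold u
  field_simp
  ring

lemma it_vals (c t : ℝ) (hc : c < 1) (ht : t = c / (1 - c)) :
    (1 + t) * uIter c 1 - t = - sF t ∧ (1 + t) * uIter c 3 - t = wF t - t ∧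
    (1 + t) * uIter c 4 - t = - sF t + (1 + t) * qF t := by
  subst ht
  have e1 : uIter c 1 = u c 0 := rfl
  have e3 : uIter c 3 = u c (u c (u c 0)) := rfl
  have e4 : uIter c 4 = u c (u c (u c (u c 0))) := rfl
  have f1 := y_iter c 0 hc
  have f2 := y_iter c (u c 0) hc
  have f3 := y_iter c (u c (u c 0)) hc
  have f4 := y_iter c (u c (u c (u c 0))) hc
  rw [e1, e3, e4]
  generalize c / (1 - c) = t at *
  have g1 : (1 + t) * u c 0 - t = - sF t := by rw [f1]; unfold sF; ring
  have g3 : (1 + t) * u c (u c (u c 0)) - t = wF t - t := by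
    rw [f3, f2, g1]; unfold wF; ring
  refine ⟨g1, g3, ?_⟩
  rw [f4, g3]; unfold qF
  have : sF t = t ^ 2 * (1 + t) - 1 := by unfold sF; ring
  rw [this]; ring

lemma R_eq (c : ℝ) (hc : c < 1) (hS : S2 c ≠ 0) : Rmap c = FF (c / (1 - c)) := by
  have h1 : (1 - c) ≠ 0 := by linarith
  obtain ⟨g1, -, g4⟩ := it_vals c _ hc rfl
  have hct : (1 + c / (1 - c)) * c = c / (1 - c) := by field_simp; ring
  have hpos : (1 + c / (1 - c)) = 1 / (1 - c) := by field_simp; ring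
  have ha : (1 + c / (1 - c)) ≠ 0 := by rw [hpos]; positivity
  generalize c / (1 - c) = t at *
  have hSe : S2 c = qF t := by
    unfold S2
    apply mul_left_cancel₀ ha
    linear_combination g4 - g1
  unfold Rmap FF
  rw [hSe] at hS ⊢
  field_simp
  linear_combination g4 + hct * (-1)

lemma key (t : ℝ) (h0 : 0 < t) (h1 : t < 1) (hs : 0 < sF t) (hw : 0 < wF t)
    (hw2 : wF t < t - sF t) (hq : qF t = sF t) :
    sF t < (1 + t) * (qD t - sD t) := by
  have hsd : sF t = t ^ 3 + t ^ 2 - 1 := rfl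
  have hwd : wF t = (1 + t) ^ 2 * sF t ^ 2 * (2 - (1 + t) * sF t ^ 2) := by unfold wF; ring
  have hqd : 2 * t * wF t - wF t ^ 2 = sF t := hq
  have hsD : sD t = 3 * t ^ 2 + 2 * t := rfl
  have hqD : qD t = 2 * wF t + 2 * (t - wF t) * wD t := rfl
  have hwD : wD t = 4 * (1 + t) ^ 2 * sF t * sD t * (1 - (1 + t) * sF t ^ 2)
    + (1 + t) * sF t ^ 2 * (4 - 3 * ((1 + t) * sF t ^ 2)) := rfl
  generalize sF t = s at *
  generalize wF t = w at *
  generalize sD t = d at *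
  generalize wD t = w' at *
  generalize qD t = q' at *
  have hsq : (t - w) ^ 2 = 1 - t ^ 3 := by rw [hsd] at hqd; linarith
  have hsq2 : s ^ 2 < 1 - t ^ 3 := by rw [← hsq]; nlinarith
  have t9 : t < 0.9 := by
    by_contra h
    push Not at h
    have a2 : (0.81:ℝ) ≤ t ^ 2 := by have := pw (by norm_num) h 2; norm_num at this ⊢; linarith
    have a3 : (0.729:ℝ) ≤ t ^ 3 := by have := pw (by norm_num) h 3; norm_num at this ⊢; linarith
    have b : 0.539 ≤ s := by linarith
    have := pw (by norm_num) b 2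
    norm_num at this
    linarith
  have t2u : t ^ 2 < 0.81 := by have := pwl h0.le t9 2 (by norm_num); norm_num at this ⊢; linarith
  have t3u : t ^ 3 < 0.729 := by have := pwl h0.le t9 3 (by norm_num); norm_num at this ⊢; linarith
  have su : s < 0.539 := by linarith
  have t85 : t < 0.85 := by
    by_contra h
    push Not at h
    have a2 : (0.7225:ℝ) ≤ t ^ 2 := by have := pw (by norm_num) h 2; norm_num at this ⊢; linarith
    have a3 : (0.6141:ℝ) ≤ t ^ 3 := by have := pw (by norm_num) h 3; norm_num at this ⊢; linarith
    have b : 0.3366 ≤ s := by linarith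
    have b2 : (0.1132:ℝ) ≤ s ^ 2 := by have := pw (by norm_num) b 2; norm_num at this ⊢; linarith
    have b3 : s ^ 2 ≤ 0.2906 := by have := pw hs.le su.le 2; norm_num at this ⊢; linarith
    have b4 : (1.44:ℝ) ≤ 2 - (1 + t) * s ^ 2 := by
      have : (1 + t) * s ^ 2 ≤ (1 + 0.9) * 0.2906 := by gcongr
      linarith
    have b5 : (3.42:ℝ) ≤ (1 + t) ^ 2 := by linarith [add_sq 1 t]
    have b6 : (3.42:ℝ) * 0.1132 ≤ (1 + t) ^ 2 * s ^ 2 := by gcongr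
    have b7 : (3.42:ℝ) * 0.1132 * 1.44 ≤ (1 + t) ^ 2 * s ^ 2 * (2 - (1 + t) * s ^ 2) := by gcongr
    have : t - s ≤ 0.514 := by linarith [mul_nonneg (sub_nonneg.2 h) h0.le, mul_nonneg (mul_nonneg (sub_nonneg.2 h) h0.le) h0.le]
    linarith
  have t2v : t ^ 2 < 0.7225 := by have := pwl h0.le t85 2 (by norm_num); norm_num at this ⊢; linarith
  have t3v : t ^ 3 < 0.61413 := by have := pwl h0.le t85 3 (by norm_num); norm_num at this ⊢; linarith
  have sv : s < 0.337 := by linarith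
  have t784 : 0.784 < t := by
    by_contra h
    push Not at h
    have a2 : t ^ 2 ≤ 0.614656 := by have := pw h0.le h 2; norm_num at this ⊢; linarith
    have a3 : t ^ 3 ≤ 0.48190 := by have := pw h0.le h 3; norm_num at this ⊢; linarith
    have b : s ≤ 0.09656 := by linarith
    have c1 : s ≤ 2 * t * w := by linarith [sq_nonneg w]
    have c2 : w ≤ 2 * (1 + t) ^ 2 * s ^ 2 := by
      have : 0 ≤ (1 + t) ^ 3 * (s ^ 2) ^ 2 := by positivity
      rw [hwd]; linarith
    have c3 : 2 * (1 + t) ^ 2 * s ^ 2 ≤ 6.3654 * s ^ 2 := by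
      gcongr; linarith [add_sq 1 t]
    have c4 : s ≤ (1.568 * 6.3654 * s) * s := by
      have : 2 * t * w ≤ 2 * 0.784 * (6.3654 * s ^ 2) := by
        have := c2.trans c3
        gcongr
      linarith
    have c5 : (1.568 * 6.3654 * s) * s < 1 * s := by
      apply mul_lt_mul_of_pos_right _ hs
      linarith
    linarith
  have t2l : 0.6146 < t ^ 2 := by have := pw (by norm_num) t784.le 2; norm_num at this ⊢; linarith
  have t3l : 0.4818 < t ^ 3 := by have := pw (by norm_num) t784.le 3; norm_num at this ⊢; linarith
  have sl : 0.0963 < s := by linarith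
  have tw : 0.62 < t - w := by
    by_contra h
    push Not at h
    have := pw (by linarith) h 2
    norm_num at this
    linarith
  have s2 : s ^ 2 < 0.1136 := by have := pw hs.le sv.le 2; norm_num at this ⊢; linarith
  have E : (1 + t) * s ^ 2 < 0.211 := by
    have : (1 + t) * s ^ 2 ≤ (1 + 0.85) * 0.1136 := by gcongr
    linarith
  have E0 : 0 ≤ (1 + t) * s ^ 2 := by positivity
  have dl : 3.4 < d := by rw [hsD]; linarith
  have p1 : (3.18:ℝ) < (1 + t) ^ 2 := by linarith [add_sq 1 t]
  have p2 : 4 * 3.18 * 0.0963 * d * 0.789 ≤ 4 * (1 + t) ^ 2 * s * d * (1 - (1 + t) * s ^ 2) := by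
    gcongr
    linarith
  have p3 : 0 ≤ (1 + t) * s ^ 2 * (4 - 3 * ((1 + t) * s ^ 2)) := by
    apply mul_nonneg E0; linarith
  have p4 : 0.96 * d ≤ w' := by rw [hwD]; linarith
  have p5 : 2 * 0.62 * (0.96 * d) ≤ 2 * (t - w) * w' := by gcongr
  have p6 : 0.5 ≤ q' - d := by rw [hqD]; linarith
  have p7 : 1 * 0.5 ≤ (1 + t) * (q' - d) := by
    gcongr
    linarith
  linarith

theorem stmt_1 (cstar : ℝ) (hc : cstar ∈ Fd) (hfix : Rmap cstar = cstar) :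
    DifferentiableAt ℝ Rmap cstar ∧ 2 < deriv Rmap cstar := by
  obtain ⟨⟨c0, c1⟩, hS1, hS2, -, hGl, -⟩ := hc
  have hc1 : cstar < 1 := by linarith
  have hcn : 1 - cstar ≠ 0 := by linarith
  have hcp : 0 < 1 - cstar := by linarith
  obtain ⟨t, ht⟩ : ∃ t, t = cstar / (1 - cstar) := ⟨_, rfl⟩
  have ht0 : 0 < t := by rw [ht]; positivity
  have ht1 : t < 1 := by rw [ht, div_lt_one hcp]; linarith
  have hat : 1 + t = 1 / (1 - cstar) := by rw [ht]; field_simp; ring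
  have hct : (1 + t) * cstar = t := by rw [hat, ht]; field_simp
  have ha : 0 < 1 + t := by linarith
  obtain ⟨g1, g3, g4⟩ := it_vals cstar t hc1 ht
  have hSe : S2 cstar = qF t := by
    unfold S2
    apply mul_left_cancel₀ ha.ne'
    linear_combination g4 - g1
  have hqp : 0 < qF t := hSe ▸ hS2
  have hqs : qF t = sF t := by
    have h := R_eq cstar hc1 hS2.ne'
    rw [hfix, ← ht] at h
    unfold FF at h
    have h2 : (1 + t) * cstar = (1 + t) - sF t / qF t := by
      rw [h]; field_simp
    rw [hct] at h2
    have h3 : sF t / qF t = 1 := by linarith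
    rw [div_eq_one_iff_eq hqp.ne'] at h3
    exact h3.symm
  have hw : 0 < wF t := by
    have : 0 < uIter cstar 3 := hS1
    have := mul_pos ha this
    linarith
  have hw2 : wF t < t - sF t := by
    have : 0 < uIter cstar 1 - uIter cstar 3 := hGl
    have := mul_pos ha this
    linarith
  have hs : 0 < sF t := hqs ▸ hqp
  have K := key t ht0 ht1 hs hw hw2 hqs
  -- derivative
  have hT : HasDerivAt (fun c : ℝ => c / (1 - c)) ((1 + t) ^ 2) cstar := by
    have h := (hasDerivAt_id cstar).div ((hasDerivAt_id cstar).const_sub 1) hcn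
    refine HasDerivAt.congr_deriv (f := fun c : ℝ => c / (1 - c)) h ?_
    rw [hat]; simp
  have hA : HasDerivAt (fun t : ℝ => 1 + t) 1 t := (hasDerivAt_id t).const_add 1
  have hF : HasDerivAt FF (((1 + t) * (qD t - sD t) + sF t) / ((1 + t) ^ 2 * sF t)) t := by
    have h := ((sF_deriv t).div (hA.mul (qF_deriv t)) (mul_pos ha hqp).ne').const_sub 1
    refine HasDerivAt.congr_deriv (f := FF) h ?_
    simp only [Pi.mul_apply, hqs]
    field_simp
    ring
  have hcomp : HasDerivAt (fun c => FF (c / (1 - c)))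
      (((1 + t) * (qD t - sD t) + sF t) / ((1 + t) ^ 2 * sF t) * (1 + t) ^ 2) cstar := by
    rw [ht] at hF
    have := HasDerivAt.comp cstar hF (ht ▸ hT)
    rw [← ht] at this
    exact this
  have hev : Rmap =ᶠ[nhds cstar] (fun c => FF (c / (1 - c))) := by
    have e1 : ∀ᶠ c in nhds cstar, c < 1 := eventually_lt_nhds hc1
    have cq : ContinuousAt (fun c : ℝ => qF (c / (1 - c))) cstar := by
      have h1 : ContinuousAt qF (cstar / (1 - cstar)) := (qF_deriv _).continuousAt
      exact ContinuousAt.comp (f := fun c : ℝ => c / (1 - c)) h1 hT.continuousAt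
    have e2 : ∀ᶠ c in nhds cstar, 0 < qF (c / (1 - c)) := by
      apply cq.eventually (lt_mem_nhds _)
      show 0 < qF (cstar / (1 - cstar))
      rw [← ht]; exact hqp
    filter_upwards [e1, e2] with c h1 h2
    apply R_eq c h1
    obtain ⟨k1, -, k4⟩ := it_vals c _ h1 rfl
    intro h0
    unfold S2 at h0
    have hpos : (1 + c / (1 - c)) = 1 / (1 - c) := by
      have : 1 - c ≠ 0 := by linarith
      field_simp; ring
    have hpp : 0 < 1 + c / (1 - c) := by
      rw [hpos]; exact one_div_pos.2 (by linarith)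
    have h5 := mul_pos hpp h2
    have h6 : uIter c 4 = uIter c 1 := by linarith
    rw [h6] at k4
    linarith
  have hR := hcomp.congr_of_eventuallyEq hev
  refine ⟨hR.differentiableAt, ?_⟩
  rw [hR.deriv]
  have : ((1 + t) * (qD t - sD t) + sF t) / ((1 + t) ^ 2 * sF t) * (1 + t) ^ 2
      = ((1 + t) * (qD t - sD t) + sF t) / sF t := by
    field_simp
  rw [this, lt_div_iff₀ hs]
  linarith
end

section
/- There exists a unique real number c₅* in the quintupling feasible domain f_d such that R₅(c₅*) = c₅*; moreover this fixed point satisfies 0.3872 < c₅* < 0.3873. -/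
/-- Period-quintupling scaling function `Q₁(c) = u_c⁵(0)`. -/
noncomputable def Q1 (c : ℝ) : ℝ := uIter c 5
/-- Period-quintupling scaling function `Q₂(c) = u_c⁸(0) − u_c³(0)`. -/
noncomputable def Q2 (c : ℝ) : ℝ := uIter c 8 - uIter c 3
/-- Period-quintupling scaling function `Q₃(c) = u_c⁶(0) − u_c(0)`. -/
noncomputable def Q3 (c : ℝ) : ℝ := uIter c 6 - uIter c 1
/-- Period-quintupling scaling function `Q₄(c) = u_c²(0) − u_c⁷(0)`. -/
noncomputable def Q4 (c : ℝ) : ℝ := uIter c 2 - uIter c 7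
/-- Period-quintupling scaling function `Q₅(c) = 1 − u_c⁴(0)`. -/
noncomputable def Q5 (c : ℝ) : ℝ := 1 - uIter c 4
/-- Gap function `H_l(c) = u_c³(0) − u_c⁵(0)`. -/
noncomputable def Hl (c : ℝ) : ℝ := uIter c 3 - uIter c 5
/-- Gap function `H₁(c) = u_c(0) − u_c⁸(0)`. -/
noncomputable def H1 (c : ℝ) : ℝ := uIter c 1 - uIter c 8
/-- Gap function `H₂(c) = u_c⁷(0) − u_c⁶(0)`. -/
noncomputable def H2 (c : ℝ) : ℝ := uIter c 7 - uIter c 6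
/-- Gap function `H₃(c) = u_c⁴(0) − u_c²(0)`. -/
noncomputable def H3 (c : ℝ) : ℝ := uIter c 4 - uIter c 2
/-- The period-quintupling renormalization map `R₅(c) = (u_c⁸(0) − c)/Q₂(c)`. -/
noncomputable def R5 (c : ℝ) : ℝ := (uIter c 8 - c) / Q2 c
/-- The quintupling feasible domain `f_d`. -/
def fd : Set ℝ :=
  {c | c ∈ Set.Ioo (0 : ℝ) (1 / 2) ∧ 0 < Q1 c ∧ 0 < Q2 c ∧ 0 < Q3 c ∧ 0 < Q4 c ∧ 0 < Q5 c ∧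
    0 < Hl c ∧ 0 < H1 c ∧ 0 < H2 c ∧ 0 < H3 c}

/-- Conjugated orbit: `yy a k = a * u_c^k(0) - (a - 1)` with `a = 1/(1-c)`. -/
noncomputable def yy (a : ℝ) : ℕ → ℝ
  | 0 => 1 - a
  | (k+1) => 1 - a * (yy a k)^2

lemma uIter_succ' (c : ℝ) (k : ℕ) : uIter c (k+1) = u c (uIter c k) := by
  unfold uIter; rw [Function.iterate_succ_apply']

lemma uIter_eq (c a : ℝ) (ha : a * (1 - c) = 1) (k : ℕ) :
    a * uIter c k = yy a k + a - 1 := by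
  have hc : (1 - c) ≠ 0 := by intro h; rw [h] at ha; simp at ha
  have hd : ∀ x : ℝ, (x - c) / (1 - c) = a * x - (a - 1) := by
    intro x; rw [div_eq_iff hc]; linear_combination (-x + 1) * ha
  induction k with
  | zero => simp [uIter, yy]
  | succ k ih =>
    rw [uIter_succ', u, hd, yy, ih]; ring

/-- Polynomial pieces, as functions of `a`. -/
noncomputable def GG (a : ℝ) : ℝ :=
  a^4 * (-yy a 3) * (2 - a * (yy a 3)^2) * (-(yy a 5 + yy a 0)) * (yy a 6 + yy a 1) * (yy a 7 + yy a 2)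

lemma diff83 (a : ℝ) : yy a 8 - yy a 3 = -yy a 3 * a * GG a := by
  have h8 : yy a 8 = 1 - a * (yy a 7)^2 := rfl
  have h7 : yy a 7 = 1 - a * (yy a 6)^2 := rfl
  have h6 : yy a 6 = 1 - a * (yy a 5)^2 := rfl
  have h5 : yy a 5 = 1 - a * (yy a 4)^2 := rfl
  have h4 : yy a 4 = 1 - a * (yy a 3)^2 := rfl
  have h3 : yy a 3 = 1 - a * (yy a 2)^2 := rfl
  have h2 : yy a 2 = 1 - a * (yy a 1)^2 := rfl
  have h1 : yy a 1 = 1 - a * (yy a 0)^2 := rfl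
  have h0 : yy a 0 = 1 - a := rfl
  have e5 : yy a 5 - yy a 0 = a^2 * (yy a 3)^2 * (2 - a * (yy a 3)^2) := by
    rw [h5, h4, h0]; ring
  have e6 : yy a 6 - yy a 1 = -a * (yy a 5 - yy a 0) * (yy a 5 + yy a 0) := by
    linear_combination h6 - h1
  have e7 : yy a 7 - yy a 2 = -a * (yy a 6 - yy a 1) * (yy a 6 + yy a 1) := by
    linear_combination h7 - h2
  have e8 : yy a 8 - yy a 3 = -a * (yy a 7 - yy a 2) * (yy a 7 + yy a 2) := by
    linear_combination h8 - h3
  rw [e8, e7, e6, e5, GG]; ring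

/-- Feasible ordering in the conjugated coordinates. -/
def FY (a : ℝ) : Prop :=
  yy a 0 < yy a 5 ∧ yy a 3 < yy a 8 ∧ yy a 1 < yy a 6 ∧ yy a 7 < yy a 2 ∧ yy a 4 < 1 ∧
  yy a 5 < yy a 3 ∧ yy a 8 < yy a 1 ∧ yy a 6 < yy a 7 ∧ yy a 2 < yy a 4

lemma fd_iff (c a : ℝ) (ha : a * (1 - c) = 1) (hc : c ∈ Set.Ioo (0:ℝ) (1/2)) :
    c ∈ fd ↔ FY a := by
  have ha0 : 0 < a := by
    by_contra h
    have := hc.2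
    nlinarith
  have key : ∀ i j : ℕ, 0 < uIter c i - uIter c j ↔ yy a j < yy a i := by
    intro i j
    have hi := uIter_eq c a ha i
    have hj := uIter_eq c a ha j
    rw [← mul_pos_iff_of_pos_left ha0, mul_sub, hi, hj]
    constructor <;> intro h <;> linarith
  have k0 : uIter c 0 = 0 := by simp [uIter]
  have k5 : 0 < uIter c 5 ↔ yy a 0 < yy a 5 := by
    rw [← key, k0, sub_zero]
  have k4 : 0 < 1 - uIter c 4 ↔ yy a 4 < 1 := by
    have h4 := uIter_eq c a ha 4
    rw [← mul_pos_iff_of_pos_left ha0, mul_sub, h4]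
    constructor <;> intro h <;> linarith
  simp only [fd, Set.mem_ofPred_eq, Q1, Q2, Q3, Q4, Q5, Hl, H1, H2, H3, FY, key, k5, k4, hc, true_and]

lemma fix_iff (c a : ℝ) (ha : a * (1 - c) = 1) (hc : c ∈ Set.Ioo (0:ℝ) (1/2)) (h : FY a) :
    R5 c = c ↔ GG a = 1 := by
  have hc' := (fd_iff c a ha hc).2 h
  have hQ : 0 < Q2 c := hc'.2.2.1
  have h8 := uIter_eq c a ha 8
  have h3 := uIter_eq c a ha 3
  have hd := diff83 a
  have h4 : yy a 4 = 1 - a * (yy a 3)^2 := rfl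
  have hv : yy a 3 ≠ 0 := by
    intro h0; have := h.2.2.2.2.1; rw [h4, h0] at this; simp at this
  have ha0 : a ≠ 0 := by intro h; rw [h] at ha; simp at ha
  have hg : a * ((uIter c 8 - c) - c * Q2 c) = yy a 3 * (1 - GG a) := by
    have hca : a * c = a - 1 := by linear_combination -ha
    have : a * ((uIter c 8 - c) - c * Q2 c) = a * uIter c 8 - a * c - c * (a * uIter c 8 - a * uIter c 3) := by
      unfold Q2; ring
    rw [this, h8, h3]
    linear_combination (1 - c) * hd - hca - yy a 3 * GG a * ha
  rw [R5, div_eq_iff hQ.ne']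
  constructor
  · intro he
    rw [he, sub_self, mul_zero] at hg
    have := (mul_eq_zero.1 hg.symm).resolve_left hv
    linarith
  · intro he
    rw [he, sub_self, mul_zero] at hg
    have := (mul_eq_zero.1 hg).resolve_left ha0
    linarith

lemma stepI {a y : ℝ} (aL aH l h : ℝ) (h0 : 0 ≤ aL) (h1 : aL ≤ a) (h2 : a ≤ aH) (h3 : 0 ≤ l)
    (h4 : l ≤ y) (h5 : y ≤ h) : 1 - aH * h^2 ≤ 1 - a * y^2 ∧ 1 - a * y^2 ≤ 1 - aL * l^2 := by
  have q1 : l^2 ≤ y^2 := by gcongr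
  have q2 : y^2 ≤ h^2 := by
    have : 0 ≤ y := h3.trans h4
    gcongr
  have q3 : aL * l^2 ≤ a * y^2 := by gcongr; linarith
  have q4 : a * y^2 ≤ aH * h^2 := by
    have : 0 ≤ aH := by linarith
    gcongr
  constructor <;> linarith

lemma loc_top (a : ℝ) (h : 0 < 1 - a * (1 - a)^2) : a ≤ 1.755 := by
  by_contra hh
  push Not at hh
  nlinarith [mul_pos (sub_pos.2 hh) (sub_pos.2 hh), mul_pos (mul_pos (sub_pos.2 hh) (sub_pos.2 hh)) (sub_pos.2 hh)]

lemma loc_bot (a y1 y2 : ℝ) (h1a : 1 < a) (h1 : y1 = 1 - a * (1 - a)^2) (h2 : y2 = 1 - a * y1^2)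
    (h3 : 1 - a * y2^2 < 0) : 1.62 ≤ a := by
  by_contra hh
  push Not at hh
  have b1 : 0.377 ≤ y1 := by
    have := (stepI (a := a) (y := a - 1) 1 1.62 0 0.62 (by norm_num) h1a.le hh.le (by norm_num) (by linarith) (by linarith)).1
    norm_num at this ⊢
    nlinarith
  have b1' : y1 ≤ 1 := by nlinarith [sq_nonneg (1-a)]
  have b2 : y2 ≤ 1 - 0.142 * a := by
    have : 0.142 ≤ y1^2 := by nlinarith
    nlinarith
  have b2' : -0.62 ≤ y2 := by
    have : y1^2 ≤ 1 := by nlinarith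
    nlinarith
  have c1 : a * (1 - 0.142 * a)^2 < 1 := by
    have : a * (1 - 0.142 * a) ≤ 1.2475 := by nlinarith
    have : 0 < 1 - 0.142 * a := by linarith
    have e : a * (1 - 0.142 * a)^2 = (a * (1 - 0.142 * a)) * (1 - 0.142*a) := by ring
    have k : 0 < 1.62 - a := by linarith
    have k1 : 0 < a - 1 := by linarith
    nlinarith [mul_pos k k1, mul_pos (mul_pos k k) k1, mul_pos (mul_pos k k1) k1]
  have c2 : a * y2^2 < 1 := by
    rcases le_total 0 y2 with h' | h'
    · have : y2^2 ≤ (1 - 0.142 * a)^2 := by gcongr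
      have : a * y2^2 ≤ a * (1 - 0.142 * a)^2 := by gcongr
      linarith
    · have : y2^2 ≤ 0.3844 := by nlinarith
      nlinarith
  linarith

lemma loc_mid (a y1 y2 V w : ℝ) (ha : a ≤ 1.755) (h1 : y1 = 1 - a * (1 - a)^2) (hy1 : 0 < y1)
    (h2 : y2 = 1 - a * y1^2) (hV : V = a * y2^2 - 1) (hw : w = a * V^2) (hw1 : w ≤ 1)
    (h5 : 1 - a * (1 - w)^2 ≤ -0.511) : a ≤ 1.65 := by
  by_contra hh
  push Not at hh
  have b1 : y1 ≤ 0.303 := by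
    have := (stepI (a := a) (y := a - 1) 1.65 1.755 0.65 0.755 (by norm_num) hh.le ha (by norm_num) (by linarith) (by linarith)).2
    norm_num at this ⊢
    nlinarith
  have b2 : a * y1 ≤ 0.5 := by
    have e : a * y1 = a - (a * (a - 1))^2 := by rw [h1]; ring
    have : 1.0725 ≤ a * (a - 1) := by nlinarith
    rw [e]; nlinarith
  have b3 : 0.8485 ≤ y2 := by nlinarith
  have b4 : 0.7199 ≤ y2^2 := by nlinarith
  have b5 : 0.7199 * a - 1 ≤ V := by nlinarith
  rcases le_total a 1.7 with h' | h'
  · have c1 : 0.1878 ≤ V := by linarith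
    have c2 : 0.0352 ≤ V^2 := by nlinarith
    have c3 : 0.058 ≤ w := by nlinarith
    have c4 : (1 - w)^2 ≤ 0.8874 := by nlinarith
    nlinarith
  · have c1 : 0.2238 ≤ V := by linarith
    have c2 : 0.05 ≤ V^2 := by nlinarith
    have c3 : 0.085 ≤ w := by nlinarith
    have c4 : (1 - w)^2 ≤ 0.838 := by nlinarith
    nlinarith

lemma loc_a (a y1 y2 V : ℝ) (ha : a ≤ 1.65) (h1 : y1 = 1 - a * (1 - a)^2) (hy1 : 0 < y1)
    (h2 : y2 = 1 - a * y1^2) (hV : V = a * y2^2 - 1) (hV1 : V ≤ 0.095) : a ≤ 1.64 := by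
  by_contra hh
  push Not at hh
  have b1 : y1 ≤ 0.329 := by
    have := (stepI (a := a) (y := a - 1) 1.64 1.65 0.64 0.65 (by norm_num) hh.le ha (by norm_num) (by linarith) (by linarith)).2
    norm_num at this ⊢
    nlinarith
  have b0 : y1^2 ≤ 0.1083 := by nlinarith
  have b2 : 0.82 ≤ y2 := by nlinarith
  have b3 : 0.6724 ≤ y2^2 := by nlinarith
  nlinarith

lemma prod_lb {x y l m : ℝ} (hl : 0 ≤ l) (hm : 0 ≤ m) (hx : l ≤ x) (hy : m ≤ y) : l * m ≤ x * y :=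
  mul_le_mul hx hy hm (hl.trans hx)

lemma small_of_mul {K y : ℝ} (h : 11 ≤ K) (e : K * (-y) = 1) (hy : y < 0) : -y ≤ 0.095 := by
  nlinarith

set_option maxHeartbeats 1000000 in
/-- Localisation of feasible fixed points. -/
lemma localise (a : ℝ) (h1a : 1 < a) (h2a : a < 2) (h : FY a) (hG : GG a = 1) :
    1.62 ≤ a ∧ a ≤ 1.64 ∧ yy a 3 < 0 ∧ -0.095 ≤ yy a 3 := by
  have hd := diff83 a
  rw [hG] at hd
  have hG' := hG
  unfold GG at hG'
  obtain ⟨f0, f1, f2, f3, f4, f5, f6, f7, f8⟩ := h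
  have h7 : yy a 7 = 1 - a * (yy a 6)^2 := rfl
  have h6 : yy a 6 = 1 - a * (yy a 5)^2 := rfl
  have h5 : yy a 5 = 1 - a * (yy a 4)^2 := rfl
  have h4 : yy a 4 = 1 - a * (yy a 3)^2 := rfl
  have h3 : yy a 3 = 1 - a * (yy a 2)^2 := rfl
  have h2 : yy a 2 = 1 - a * (yy a 1)^2 := rfl
  have h1 : yy a 1 = 1 - a * (yy a 0)^2 := rfl
  have h0 : yy a 0 = 1 - a := rfl
  clear hG
  generalize yy a 8 = y8 at *
  generalize yy a 7 = y7 at *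
  generalize yy a 6 = y6 at *
  generalize yy a 5 = y5 at *
  generalize yy a 4 = y4 at *
  generalize yy a 3 = y3 at *
  generalize yy a 2 = y2 at *
  generalize yy a 1 = y1 at *
  generalize yy a 0 = y0 at *
  subst h0
  have hv : y3 < 0 := by nlinarith
  have hy8 : 0 < y8 := by nlinarith
  have hy1 : 0 < y1 := by linarith
  have hy6 : 0 < y6 := by linarith
  have hy2 : 0 < y2 := by linarith
  have ha : a ≤ 1.755 := loc_top a (by linarith)
  have hlo : 1.62 ≤ a := loc_bot a y1 y2 h1a h1 h2 (by linarith)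
  clear hd f1 f6
  have e6 : y6 ≤ 0.541 := by
    by_contra hh
    push Not at hh
    have := (stepI (a := a) (y := y6) 1.62 1.755 0.541 1 (by norm_num) hlo ha (by norm_num) hh.le (by nlinarith [sq_nonneg y5])).2
    norm_num at this hh
    linarith
  have e5 : y5 ≤ -0.511 := by
    by_contra hh
    push Not at hh
    have := (stepI (a := a) (y := -y5) 1.62 1.755 0 0.511 (by norm_num) hlo ha (by norm_num) (by linarith) (by linarith)).1
    norm_num at this e6
    linarith
  obtain ⟨w, hw⟩ : ∃ w, w = a * (-y3)^2 := ⟨_, rfl⟩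
  have hw4 : y4 = 1 - w := by rw [hw, h4]; ring
  have ha2 : a ≤ 1.65 := loc_mid a y1 y2 (-y3) w ha h1 hy1 h2 (by linarith) hw (by linarith)
    (by rw [← hw4]; linarith)
  have e5 : y5 ≤ -0.527 := by
    by_contra hh
    push Not at hh
    have := (stepI (a := a) (y := -y5) 1.62 1.65 0 0.527 (by norm_num) hlo ha2 (by norm_num) (by linarith) (by linarith)).1
    norm_num at this e6
    linarith
  have w0 : 0 ≤ w := by rw [hw]; positivity
  have e4 : 0.96 ≤ y4 := by
    by_contra hh
    push Not at hh
    have := (stepI (a := a) (y := y4) 1.62 1.65 0 0.96 (by norm_num) hlo ha2 (by norm_num) (by linarith) (by linarith)).1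
    norm_num at this e5
    linarith
  have t1 : 0.302 ≤ y1 := by
    have := (stepI (a := a) (y := a - 1) 1.62 1.65 0.62 0.65 (by norm_num) hlo ha2 (by norm_num) (by linarith) (by linarith)).1
    norm_num at this ⊢
    have e : y1 = 1 - a * (a - 1)^2 := by rw [h1]; ring
    linarith
  have t1' : y1 ≤ 0.378 := by
    have := (stepI (a := a) (y := a - 1) 1.62 1.65 0.62 0.65 (by norm_num) hlo ha2 (by norm_num) (by linarith) (by linarith)).2
    norm_num at this ⊢
    have e : y1 = 1 - a * (a - 1)^2 := by rw [h1]; ring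
    linarith
  have t2 : 0.764 ≤ y2 := by
    have := (stepI (a := a) (y := y1) 1.62 1.65 0.302 0.378 (by norm_num) hlo ha2 (by norm_num) t1 t1').1
    norm_num at this ⊢
    linarith
  have t7 : 0.517 ≤ y7 := by
    have := (stepI (a := a) (y := y6) 1.62 1.65 0 0.541 (by norm_num) hlo ha2 (by norm_num) hy6.le e6).1
    norm_num at this ⊢
    linarith
  have p1 : (1.62:ℝ)^4 ≤ a^4 := by gcongr
  have p2 : 1.96 ≤ 2 - a * y3^2 := by linarith
  have p3 : 1.147 ≤ -(y5 + (1 - a)) := by linarith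
  have p4 : 0.604 ≤ y6 + y1 := by linarith
  have p5 : 1.281 ≤ y7 + y2 := by linarith
  have q1 := prod_lb (by norm_num) (by norm_num) p1 p2
  have q2 := prod_lb (by norm_num) (by norm_num) q1 p3
  have q3 := prod_lb (by norm_num) (by norm_num) q2 p4
  have q4 := prod_lb (by norm_num) (by norm_num) q3 p5
  have hVb : -y3 ≤ 0.095 := by
    have e : a ^ 4 * (2 - a * y3 ^ 2) * -(y5 + (1 - a)) * (y6 + y1) * (y7 + y2) * (-y3) = 1 := by
      linear_combination hG'
    have : (11:ℝ) ≤ a ^ 4 * (2 - a * y3 ^ 2) * -(y5 + (1 - a)) * (y6 + y1) * (y7 + y2) := by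
      refine le_trans ?_ q4; norm_num
    generalize a ^ 4 * (2 - a * y3 ^ 2) * -(y5 + (1 - a)) * (y6 + y1) * (y7 + y2) = K at *
    exact small_of_mul this e hv
  refine ⟨hlo, loc_a a y1 y2 (-y3) ha2 h1 hy1 h2 (by linarith) hVb, hv, by linarith⟩

section slopes
variable {a b y z aL aH l h t s : ℝ}

lemma incU (h1 : aL ≤ a) (h2 : a ≤ aH) (h0 : 0 ≤ aL) (hab : a ≤ b) (hl : 0 ≤ l)
    (hy : l ≤ y ∧ y ≤ h) (hz : l ≤ z ∧ z ≤ h) (ht : 0 ≤ t) (hs : z - y ≤ t * (b - a)) :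
    (1 - a * y^2) - (1 - b * z^2) ≤ (h^2 + 2 * aH * t * h) * (b - a) := by
  obtain ⟨hy1, hy2⟩ := hy
  obtain ⟨hz1, hz2⟩ := hz
  have hd : 0 ≤ b - a := by linarith
  have e1 : (b - a) * z^2 ≤ (b - a) * h^2 := by
    have : 0 ≤ z := by linarith
    gcongr
  have e2 : (z - y) * (a * (y + z)) ≤ (t * (b - a)) * (a * (y + z)) := by
    have : 0 ≤ a * (y + z) := mul_nonneg (by linarith) (by linarith)
    gcongr
  have e3 : (t * (b - a)) * (a * (y + z)) ≤ (t * (b - a)) * (aH * (h + h)) := by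
    have : 0 ≤ y + z := by linarith
    have : 0 ≤ aH := by linarith
    gcongr
  nlinarith

lemma incL (h1 : aL ≤ a) (h0 : 0 ≤ aL) (hab : a ≤ b) (hl : 0 ≤ l)
    (hy : l ≤ y) (hz : l ≤ z) (ht : 0 ≤ s) (hs : s * (b - a) ≤ z - y) :
    (l^2 + 2 * aL * s * l) * (b - a) ≤ (1 - a * y^2) - (1 - b * z^2) := by
  have hd : 0 ≤ b - a := by linarith
  have e1 : (b - a) * l^2 ≤ (b - a) * z^2 := by gcongr
  have e2 : (s * (b - a)) * (a * (y + z)) ≤ (z - y) * (a * (y + z)) := by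
    have : 0 ≤ a * (y + z) := mul_nonneg (by linarith) (by linarith)
    gcongr
  have e3 : (s * (b - a)) * (aL * (l + l)) ≤ (s * (b - a)) * (a * (y + z)) := by
    have : 0 ≤ a := by linarith
    gcongr
  nlinarith

lemma decU (h1 : aL ≤ a) (h2 : a ≤ aH) (h0 : 0 ≤ aL) (hab : a ≤ b) (hl : 0 ≤ l)
    (hy : l ≤ y ∧ y ≤ h) (hz : l ≤ z ∧ z ≤ h) (ht : 0 ≤ t) (hs : y - z ≤ t * (b - a)) :
    (1 - b * z^2) - (1 - a * y^2) ≤ (2 * aH * t * h - l^2) * (b - a) := by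
  obtain ⟨hy1, hy2⟩ := hy
  obtain ⟨hz1, hz2⟩ := hz
  have hd : 0 ≤ b - a := by linarith
  have e1 : (b - a) * l^2 ≤ (b - a) * z^2 := by gcongr
  have e2 : (y - z) * (a * (y + z)) ≤ (t * (b - a)) * (a * (y + z)) := by
    have : 0 ≤ a * (y + z) := mul_nonneg (by linarith) (by linarith)
    gcongr
  have e3 : (t * (b - a)) * (a * (y + z)) ≤ (t * (b - a)) * (aH * (h + h)) := by
    have : 0 ≤ y + z := by linarith
    have : 0 ≤ aH := by linarith
    gcongr
  nlinarith

lemma decL (h1 : aL ≤ a) (h0 : 0 ≤ aL) (hab : a ≤ b) (hl : 0 ≤ l)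
    (hy : l ≤ y) (hz : l ≤ z ∧ z ≤ h) (ht : 0 ≤ s) (hs : s * (b - a) ≤ y - z) :
    (2 * aL * s * l - h^2) * (b - a) ≤ (1 - b * z^2) - (1 - a * y^2) := by
  obtain ⟨hz1, hz2⟩ := hz
  have hd : 0 ≤ b - a := by linarith
  have e1 : (b - a) * z^2 ≤ (b - a) * h^2 := by
    have : 0 ≤ z := by linarith
    gcongr
  have e2 : (s * (b - a)) * (a * (y + z)) ≤ (y - z) * (a * (y + z)) := by
    have : 0 ≤ a * (y + z) := mul_nonneg (by linarith) (by linarith)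
    gcongr
  have e3 : (s * (b - a)) * (aL * (l + l)) ≤ (s * (b - a)) * (a * (y + z)) := by
    have : 0 ≤ a := by linarith
    gcongr
  nlinarith

end slopes

lemma rel_slope {f g m r s d : ℝ} (hd : 0 ≤ d) (hm : m ≤ g) (h : f - g ≤ s * d) (hr : 0 ≤ r)
    (hs : s ≤ r * m) : f ≤ g * (1 + r * d) := by
  have : s * d ≤ r * m * d := by gcongr
  have : r * m * d ≤ r * g * d := by gcongr
  linarith

/-- Bounds for the orbit on the working region. -/
lemma bounds (a : ℝ) (h1 : 1.62 ≤ a) (h2 : a ≤ 1.64) (h3 : yy a 3 < 0) (h4 : -0.095 ≤ yy a 3) :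
    (0.328 ≤ yy a 1 ∧ yy a 1 ≤ 0.378) ∧ (0.765 ≤ yy a 2 ∧ yy a 2 ≤ 0.826) ∧
    (0.985 ≤ yy a 4 ∧ yy a 4 ≤ 1) ∧ (0.571 ≤ -yy a 5 ∧ -yy a 5 ≤ 0.64) ∧
    (0.328 ≤ yy a 6 ∧ yy a 6 ≤ 0.472) ∧ 0.634 ≤ yy a 7 := by
  have e7 : yy a 7 = 1 - a * (yy a 6)^2 := rfl
  have e6 : yy a 6 = 1 - a * (-yy a 5)^2 := by rw [neg_sq]; rfl
  have e5 : yy a 5 = 1 - a * (yy a 4)^2 := rfl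
  have e4 : yy a 4 = 1 - a * (-yy a 3)^2 := by rw [neg_sq]; rfl
  have e2 : yy a 2 = 1 - a * (yy a 1)^2 := rfl
  have e1 : yy a 1 = 1 - a * (a - 1)^2 := by
    have : yy a 1 = 1 - a * (1 - a)^2 := rfl
    rw [this]; ring
  have i1 := stepI (a := a) (y := a - 1) 1.62 1.64 0.62 0.64 (by norm_num) h1 h2 (by norm_num) (by linarith) (by linarith)
  rw [← e1] at i1
  have j1 : 0.328 ≤ yy a 1 ∧ yy a 1 ≤ 0.378 :=
    ⟨le_trans (by norm_num) i1.1, i1.2.trans (by norm_num)⟩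
  have i2 := stepI 1.62 1.64 _ _ (by norm_num) h1 h2 (by norm_num) j1.1 j1.2
  rw [← e2] at i2
  have j2 : 0.765 ≤ yy a 2 ∧ yy a 2 ≤ 0.826 :=
    ⟨le_trans (by norm_num) i2.1, i2.2.trans (by norm_num)⟩
  have i4 := stepI (a := a) (y := -yy a 3) 1.62 1.64 0 0.095 (by norm_num) h1 h2 (by norm_num) (by linarith) (by linarith)
  rw [← e4] at i4
  have j4 : 0.985 ≤ yy a 4 ∧ yy a 4 ≤ 1 :=
    ⟨le_trans (by norm_num) i4.1, i4.2.trans (by norm_num)⟩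
  have i5 := stepI 1.62 1.64 _ _ (by norm_num) h1 h2 (by norm_num) j4.1 j4.2
  rw [← e5] at i5
  have j5 : 0.571 ≤ -yy a 5 ∧ -yy a 5 ≤ 0.64 := by
    norm_num at i5 ⊢
    constructor <;> linarith
  have i6 := stepI 1.62 1.64 _ _ (by norm_num) h1 h2 (by norm_num) j5.1 j5.2
  rw [← e6] at i6
  have j6 : 0.328 ≤ yy a 6 ∧ yy a 6 ≤ 0.472 :=
    ⟨le_trans (by norm_num) i6.1, i6.2.trans (by norm_num)⟩
  have i7 := stepI 1.62 1.64 _ _ (by norm_num) h1 h2 (by norm_num) j6.1 j6.2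
  rw [← e7] at i7
  exact ⟨j1, j2, j4, j5, j6, le_trans (by norm_num) i7.1⟩

lemma le_slope {x k m d : ℝ} (h : x ≤ k * d) (hd : 0 ≤ d) (hk : k ≤ m) : x ≤ m * d :=
  h.trans (by gcongr)

lemma slope_le {x k m d : ℝ} (h : k * d ≤ x) (hd : 0 ≤ d) (hk : m ≤ k) : m * d ≤ x :=
  le_trans (by gcongr) h

lemma final_ineq {V A B C D V' A' B' C' D' d : ℝ} (hd : 0 < d) (hd2 : d ≤ 0.02)
    (hA : 0 < A) (hB : 0 < B) (hC : 0 < C) (hD : 0 < D)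
    (hV' : 0 < V') (hA' : 0 < A') (hB' : 0 < B') (hC' : 0 < C') (hD' : 0 < D')
    (kV : V * (1 + 68 * d) ≤ V') (kA : A ≤ A' * (1 + 2 * d)) (kB : B ≤ B' * (1 + 7 * d))
    (kC : C ≤ C' * (1 + 8 * d)) (kD : D ≤ D' * (1 + 18 * d)) :
    V * A * B * C * D < V' * A' * B' * C' * D' := by
  have s1 : (V * (1 + 68 * d)) * A * B * C * D ≤
      V' * (A' * (1 + 2 * d)) * (B' * (1 + 7 * d)) * (C' * (1 + 8 * d)) * (D' * (1 + 18 * d)) := by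
    gcongr
  have s2 : (1 + 2 * d) * (1 + 7 * d) * (1 + 8 * d) * (1 + 18 * d) < 1 + 68 * d := by
    have t1 : (1 + 2 * d) * (1 + 7 * d) ≤ 1 + 10 * d := by nlinarith
    have t2 : (1 + 8 * d) * (1 + 18 * d) ≤ 1 + 30 * d := by nlinarith
    have t3 : ((1 + 2 * d) * (1 + 7 * d)) * ((1 + 8 * d) * (1 + 18 * d)) ≤ (1 + 10 * d) * (1 + 30 * d) := by
      gcongr
    nlinarith
  have K' : 0 < V' * A' * B' * C' * D' := by positivity
  have s3 : (V * A * B * C * D) * (1 + 68 * d) < (V' * A' * B' * C' * D') * (1 + 68 * d) := by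
    calc _ = (V * (1 + 68 * d)) * A * B * C * D := by ring
      _ ≤ _ := s1
      _ = (V' * A' * B' * C' * D') * ((1 + 2 * d) * (1 + 7 * d) * (1 + 8 * d) * (1 + 18 * d)) := by ring
      _ < _ := by gcongr
  exact lt_of_mul_lt_mul_right s3 (by linarith)

/-- The region on which `GG` is strictly increasing. -/
def Reg (a : ℝ) : Prop := 1.62 ≤ a ∧ a ≤ 1.64 ∧ yy a 3 < 0 ∧ -0.095 ≤ yy a 3

set_option maxHeartbeats 2000000 in
lemma GG_mono (a b : ℝ) (ha : Reg a) (hb : Reg b) (hab : a < b) : GG a < GG b := by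
  obtain ⟨a1, a2, a3, a4⟩ := ha
  obtain ⟨b1, b2, b3, b4⟩ := hb
  obtain ⟨p1, p2, p4, p5, p6, p7⟩ := bounds a a1 a2 a3 a4
  obtain ⟨q1, q2, q4, q5, q6, q7⟩ := bounds b b1 b2 b3 b4
  have e7 : ∀ a, yy a 7 = 1 - a * (yy a 6)^2 := fun _ => rfl
  have e6 : ∀ a, yy a 6 = 1 - a * (-yy a 5)^2 := fun a => by rw [neg_sq]; rfl
  have e5 : ∀ a, yy a 5 = 1 - a * (yy a 4)^2 := fun _ => rfl
  have e4 : ∀ a, yy a 4 = 1 - a * (-yy a 3)^2 := fun a => by rw [neg_sq]; rfl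
  have e3 : ∀ a, yy a 3 = 1 - a * (yy a 2)^2 := fun _ => rfl
  have e2 : ∀ a, yy a 2 = 1 - a * (yy a 1)^2 := fun _ => rfl
  have e1 : ∀ a, yy a 1 = 1 - a * (a - 1)^2 := fun a => by
    have : yy a 1 = 1 - a * (1 - a)^2 := rfl
    rw [this]; ring
  have hd : 0 ≤ b - a := by linarith
  have n1 : (0:ℝ) ≤ 1.62 := by norm_num
  have s1 : yy a 1 - yy b 1 ≤ 2.51 * (b - a) := by
    have := incU (y := a - 1) (z := b - 1) (l := 0.62) (h := 0.64) (t := 1) a1 a2 n1 hab.le (by norm_num)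
      ⟨by linarith, by linarith⟩ ⟨by linarith, by linarith⟩ (by norm_num) (by linarith)
    rw [← e1, ← e1] at this
    exact le_slope this hd (by norm_num)
  have s1' : 2.39 * (b - a) ≤ yy a 1 - yy b 1 := by
    have := incL (y := a - 1) (z := b - 1) (l := 0.62) (s := 1) a1 n1 hab.le (by norm_num)
      (by linarith) (by linarith) (by norm_num) (by linarith)
    rw [← e1, ← e1] at this
    exact slope_le this hd (by norm_num)
  have s2 : yy b 2 - yy a 2 ≤ 3.01 * (b - a) := by
    have := decU a1 a2 n1 hab.le (by norm_num) p1 q1 (by norm_num) s1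
    rw [← e2, ← e2] at this
    exact le_slope this hd (by norm_num)
  have s2' : 2.39 * (b - a) ≤ yy b 2 - yy a 2 := by
    have := decL a1 n1 hab.le (by norm_num) p1.1 q1 (by norm_num) s1'
    rw [← e2, ← e2] at this
    exact slope_le this hd (by norm_num)
  have s3 : -yy b 3 - -yy a 3 ≤ 8.85 * (b - a) := by
    have := incU a1 a2 n1 hab.le (by norm_num) p2 q2 (by norm_num) s2
    rw [← e3, ← e3] at this
    have := le_slope (m := 8.85) this hd (by norm_num)
    linarith
  have s3' : 6.5 * (b - a) ≤ -yy b 3 - -yy a 3 := by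
    have := incL a1 n1 hab.le (by norm_num) p2.1 q2.1 (by norm_num) s2'
    rw [← e3, ← e3] at this
    have := slope_le (m := 6.5) this hd (by norm_num)
    linarith
  have s4 : yy a 4 - yy b 4 ≤ 2.78 * (b - a) := by
    have := incU (l := 0) (h := 0.095) a1 a2 n1 hab.le (by norm_num) ⟨by linarith, by linarith⟩
      ⟨by linarith, by linarith⟩ (by norm_num) s3
    rw [← e4, ← e4] at this
    exact le_slope this hd (by norm_num)
  have s4' : 0 * (b - a) ≤ yy a 4 - yy b 4 := by
    have := incL (l := 0) a1 n1 hab.le (by norm_num) (by linarith) (by linarith) (by norm_num) s3'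
    rw [← e4, ← e4] at this
    exact slope_le this hd (by norm_num)
  have s5 : -yy a 5 - -yy b 5 ≤ 8.15 * (b - a) := by
    have := decU a1 a2 n1 hab.le (by norm_num) p4 q4 (by norm_num) s4
    rw [← e5, ← e5] at this
    have := le_slope (m := 8.15) this hd (by norm_num)
    linarith
  have s5' : -yy b 5 - -yy a 5 ≤ 1 * (b - a) := by
    have := decL a1 n1 hab.le (by norm_num) p4.1 q4 (by norm_num) s4'
    rw [← e5, ← e5] at this
    have := slope_le (m := -1) this hd (by norm_num)
    linarith
  have s6 : yy b 6 - yy a 6 ≤ 16.8 * (b - a) := by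
    have := decU a1 a2 n1 hab.le (by norm_num) p5 q5 (by norm_num) s5
    rw [← e6, ← e6] at this
    exact le_slope this hd (by norm_num)
  have s6' : yy a 6 - yy b 6 ≤ 2.51 * (b - a) := by
    have := incU a1 a2 n1 hab.le (by norm_num) p5 q5 (by norm_num) s5'
    rw [← e6, ← e6] at this
    exact le_slope this hd (by norm_num)
  have s7 : yy a 7 - yy b 7 ≤ 26.3 * (b - a) := by
    have := incU a1 a2 n1 hab.le (by norm_num) p6 q6 (by norm_num) s6
    rw [← e7, ← e7] at this
    exact le_slope this hd (by norm_num)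
  have y0 : ∀ a, yy a 0 = 1 - a := fun _ => rfl
  have kV : (-yy a 3) * (1 + 68 * (b - a)) ≤ -yy b 3 := by
    have : (-yy a 3) * (b - a) ≤ 0.095 * (b - a) := by
      have : -yy a 3 ≤ 0.095 := by linarith
      gcongr
    linarith
  have kA : 1 + yy a 4 ≤ (1 + yy b 4) * (1 + 2 * (b - a)) :=
    rel_slope (m := 1.98) (s := 2.78) hd (by linarith) (by linarith) (by norm_num) (by norm_num)
  have kB : -(yy a 5 + yy a 0) ≤ (-(yy b 5 + yy b 0)) * (1 + 7 * (b - a)) :=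
    rel_slope (m := 1.19) (s := 7.15) hd (by rw [y0]; linarith) (by rw [y0, y0]; linarith) (by norm_num) (by norm_num)
  have kC : yy a 6 + yy a 1 ≤ (yy b 6 + yy b 1) * (1 + 8 * (b - a)) :=
    rel_slope (m := 0.656) (s := 5.02) hd (by linarith) (by linarith) (by norm_num) (by norm_num)
  have kD : yy a 7 + yy a 2 ≤ (yy b 7 + yy b 2) * (1 + 18 * (b - a)) :=
    rel_slope (m := 1.399) (s := 23.95) hd (by linarith) (by linarith) (by norm_num) (by norm_num)
  have hfin := final_ineq (sub_pos.2 hab) (by linarith) (by linarith) (by rw [y0]; linarith) (by linarith)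
    (by linarith) (by linarith) (by linarith) (by rw [y0]; linarith) (by linarith) (by linarith) kV kA kB kC kD
  have g : ∀ a, GG a = a^4 * (-yy a 3 * (1 + yy a 4) * (-(yy a 5 + yy a 0)) * (yy a 6 + yy a 1) * (yy a 7 + yy a 2)) := by
    intro a
    have : yy a 4 = 1 - a * (yy a 3)^2 := rfl
    rw [GG, this]; ring
  have hpos : 0 < -yy b 3 * (1 + yy b 4) * (-(yy b 5 + yy b 0)) * (yy b 6 + yy b 1) * (yy b 7 + yy b 2) := by
    have x1 : 0 < -yy b 3 := by linarith
    have x2 : 0 < 1 + yy b 4 := by linarith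
    have x3 : 0 < -(yy b 5 + yy b 0) := by rw [y0]; linarith
    have x4 : 0 < yy b 6 + yy b 1 := by linarith
    have x5 : 0 < yy b 7 + yy b 2 := by linarith
    exact mul_pos (mul_pos (mul_pos (mul_pos x1 x2) x3) x4) x5
  rw [g, g]
  have a0 : 0 < a := by linarith
  have hp : a^4 ≤ b^4 := by gcongr
  calc _ < a^4 * _ := mul_lt_mul_of_pos_left hfin (by positivity)
    _ ≤ _ := mul_le_mul_of_nonneg_right hp hpos.le

lemma GG_left : GG (625/383) < 1 := by
  norm_num [GG, yy]

lemma GG_right : 1 < GG (10000/6127) := by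
  norm_num [GG, yy]

lemma reg_left : Reg (625/383) := by
  norm_num [Reg, yy]

lemma reg_right : Reg (10000/6127) := by
  norm_num [Reg, yy]

lemma yy_cont (k : ℕ) : Continuous fun a => yy a k := by
  induction k with
  | zero => simp only [yy]; fun_prop
  | succ k ih => simp only [yy]; fun_prop

lemma GG_cont : Continuous GG := by
  unfold GG
  have := yy_cont
  fun_prop

lemma feasible (a : ℝ) (h1 : 1.6318 ≤ a) (h2 : a ≤ 1.6322) (hG : GG a = 1) : FY a := by
  have e7 : yy a 7 = 1 - a * (yy a 6)^2 := rfl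
  have e6 : yy a 6 = 1 - a * (-yy a 5)^2 := by rw [neg_sq]; rfl
  have e5 : yy a 5 = 1 - a * (yy a 4)^2 := rfl
  have e4 : yy a 4 = 1 - a * (-yy a 3)^2 := by rw [neg_sq]; rfl
  have e3 : yy a 3 = 1 - a * (yy a 2)^2 := rfl
  have e2 : yy a 2 = 1 - a * (yy a 1)^2 := rfl
  have e1 : yy a 1 = 1 - a * (a - 1)^2 := by
    have : yy a 1 = 1 - a * (1 - a)^2 := rfl
    rw [this]; ring
  have e0 : yy a 0 = 1 - a := rfl
  have n : (0:ℝ) ≤ 1.6318 := by norm_num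
  have i1 := stepI (a := a) (y := a - 1) 1.6318 1.6322 0.6318 0.6322 n h1 h2 (by norm_num) (by linarith) (by linarith)
  rw [← e1] at i1
  have j1 : 0.3476 ≤ yy a 1 ∧ yy a 1 ≤ 0.3487 :=
    ⟨le_trans (by norm_num) i1.1, i1.2.trans (by norm_num)⟩
  have i2 := stepI _ _ _ _ n h1 h2 (by norm_num) j1.1 j1.2
  rw [← e2] at i2
  have j2 : 0.8015 ≤ yy a 2 ∧ yy a 2 ≤ 0.803 :=
    ⟨le_trans (by norm_num) i2.1, i2.2.trans (by norm_num)⟩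
  have i3 := stepI _ _ _ _ n h1 h2 (by norm_num) j2.1 j2.2
  rw [← e3] at i3
  have j3 : 0.048 ≤ -yy a 3 ∧ -yy a 3 ≤ 0.053 := by
    norm_num at i3 ⊢
    constructor <;> linarith
  have i4 := stepI _ _ _ _ n h1 h2 (by norm_num) j3.1 j3.2
  rw [← e4] at i4
  have j4 : 0.995 ≤ yy a 4 ∧ yy a 4 ≤ 0.997 :=
    ⟨le_trans (by norm_num) i4.1, i4.2.trans (by norm_num)⟩
  have i5 := stepI _ _ _ _ n h1 h2 (by norm_num) j4.1 j4.2
  rw [← e5] at i5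
  have j5 : 0.615 ≤ -yy a 5 ∧ -yy a 5 ≤ 0.623 := by
    norm_num at i5 ⊢
    constructor <;> linarith
  have i6 := stepI _ _ _ _ n h1 h2 (by norm_num) j5.1 j5.2
  rw [← e6] at i6
  have j6 : 0.366 ≤ yy a 6 ∧ yy a 6 ≤ 0.384 :=
    ⟨le_trans (by norm_num) i6.1, i6.2.trans (by norm_num)⟩
  have i7 := stepI _ _ _ _ n h1 h2 (by norm_num) j6.1 j6.2
  rw [← e7] at i7
  have j7 : 0.75 ≤ yy a 7 ∧ yy a 7 ≤ 0.783 :=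
    ⟨le_trans (by norm_num) i7.1, i7.2.trans (by norm_num)⟩
  have hd := diff83 a
  rw [hG] at hd
  have h8 : yy a 8 = (-yy a 3) * (a - 1) := by linear_combination hd
  have j8 : 0 ≤ yy a 8 := by
    rw [h8]; exact mul_nonneg (by linarith) (by linarith)
  have j8' : yy a 8 ≤ 0.053 * 1 := by
    rw [h8]; exact mul_le_mul j3.2 (by linarith) (by linarith) (by norm_num)
  refine ⟨?_, ?_, ?_, ?_, ?_, ?_, ?_, ?_, ?_⟩ <;> linarith

lemma sol_loc (a : ℝ) (ha : Reg a) (hG : GG a = 1) : 625/383 < a ∧ a < 10000/6127 := by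
  constructor
  · by_contra h
    push Not at h
    rcases h.lt_or_eq with h | h
    · have := GG_mono _ _ ha reg_left h
      linarith [GG_left]
    · have := GG_left; rw [← h] at this; linarith
  · by_contra h
    push Not at h
    rcases h.lt_or_eq with h | h
    · have := GG_mono _ _ reg_right ha h
      linarith [GG_right]
    · have := GG_right; rw [h] at this; linarith

lemma sol_uniq (a b : ℝ) (ha : Reg a) (hb : Reg b) (hGa : GG a = 1) (hGb : GG b = 1) : a = b := by
  rcases lt_trichotomy a b with h | h | h
  · have := GG_mono _ _ ha hb h; linarith
  · exact h
  · have := GG_mono _ _ hb ha h; linarith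

lemma c_to_a (c : ℝ) (hc : c ∈ fd) (hR : R5 c = c) : Reg (1 / (1 - c)) ∧ GG (1 / (1 - c)) = 1 := by
  have hc1 := hc.1
  have hp : 0 < 1 - c := by linarith [hc1.2]
  have ha : 1 / (1 - c) * (1 - c) = 1 := by field_simp
  have hF := (fd_iff c _ ha hc1).1 hc
  have hG := (fix_iff c _ ha hc1 hF).1 hR
  refine ⟨localise _ ?_ ?_ hF hG, hG⟩
  · rw [lt_div_iff₀ hp]; linarith [hc1.1]
  · rw [div_lt_iff₀ hp]; linarith [hc1.2]

/-- There is a unique fixed point of the period-quintupling renormalization map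
`R₅` in the quintupling feasible domain `f_d`, and it lies in `(0.3872, 0.3873)`. -/
theorem stmt_14 :
    (∃! c : ℝ, c ∈ fd ∧ R5 c = c) ∧
    ∀ c : ℝ, c ∈ fd → R5 c = c → 0.3872 < c ∧ c < 0.3873 := by
  have huniq : ∀ c d : ℝ, c ∈ fd ∧ R5 c = c → d ∈ fd ∧ R5 d = d → d = c := by
    intro c d hc hd
    obtain ⟨r1, g1⟩ := c_to_a c hc.1 hc.2
    obtain ⟨r2, g2⟩ := c_to_a d hd.1 hd.2
    have := sol_uniq _ _ r1 r2 g1 g2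
    rw [one_div, one_div, inv_inj] at this
    linarith
  constructor
  · obtain ⟨a, ha, hG⟩ := intermediate_value_Icc (by norm_num : (625/383 : ℝ) ≤ 10000/6127)
      GG_cont.continuousOn ⟨GG_left.le, GG_right.le⟩
    obtain ⟨ha1, ha2⟩ := ha
    have hF : FY a := feasible a (le_trans (by norm_num) ha1) (ha2.trans (by norm_num)) hG
    have hp : 0 < a := lt_of_lt_of_le (by norm_num) ha1
    have hac : a * (1 - (1 - 1 / a)) = 1 := by field_simp; ring
    have hc : (1 - 1 / a) ∈ Set.Ioo (0:ℝ) (1/2) := by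
      have l1 : 1 / a < 1 := by
        rw [div_lt_iff₀ hp, one_mul]; exact lt_of_lt_of_le (by norm_num) ha1
      have l2 : 1 / 2 < 1 / a := by
        rw [lt_div_iff₀ hp]
        have : a < 2 := lt_of_le_of_lt ha2 (by norm_num)
        linarith
      constructor <;> linarith
    have hsol : (1 - 1 / a) ∈ fd ∧ R5 (1 - 1 / a) = 1 - 1 / a :=
      ⟨(fd_iff _ a hac hc).2 hF, (fix_iff _ a hac hc hF).2 hG⟩
    exact ⟨1 - 1 / a, hsol, fun d hd => huniq _ d hsol hd⟩
  · intro c hc hR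
    obtain ⟨r1, g1⟩ := c_to_a c hc hR
    obtain ⟨l, r⟩ := sol_loc _ r1 g1
    have hp : 0 < 1 - c := by linarith [hc.1.2]
    rw [lt_div_iff₀ hp] at l
    rw [div_lt_iff₀ hp] at r
    constructor
    · norm_num; linarith
    · norm_num; linarith
end
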